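/- Let a, b, c be pairwise coprime integers with 1 < a < b < c, (a,b,c) ≠ (2,3,5), and (a,b) ≠ (2,3) (i.e., (a,b,c) is not of the form (2,3,6n−1) with n ≥ 2 or (2,3,6n+1) with n ≥ 1). Set N = abc − ab − ac − bc, let e₀, p₁, p₂, p₃ be the unique integers with 0 < p₁ < a, 0 < p₂ < b, 0 < p₃ < c and abc·e₀ + p₁·bc + p₂·ac + p₃·ab = −1, define Δ(n) = 1 − e₀·n − ⌈p₁n/a⌉ − ⌈p₂n/b⌉ − ⌈p₃n/c⌉ and τ(i) = Σ_{n=0}^{i−1} Δ(n). Then every global maximum of τ is trivial: for every integer n ∈ [0, N+1] with τ(n) = 1, either τ(i) = 1 for all integers i with 1 ≤ i ≤ n, or τ(i) = 1 for all integers i with n ≤ i ≤ N. -/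

import Mathlib

open Finset

/-- Membership in the numerical semigroup generated by `bc`, `ac` and `ab`. -/
def InSemigroup (a b c k : ℤ) : Prop :=
  ∃ x y z : ℤ, 0 ≤ x ∧ 0 ≤ y ∧ 0 ≤ z ∧ k = x * (b * c) + y * (a * c) + z * (a * b)

lemma ceil_mul_div_eq {a p n x m : ℤ} (hx : 0 ≤ x) (hxa : x < a) (h : a * m = p * n + x) :
    ⌈((p : ℚ) * (n : ℚ)) / (a : ℚ)⌉ = m := by
  have ha : (0 : ℚ) < a := by exact_mod_cast hx.trans_lt hxa
  have h' : (a : ℚ) * m = p * n + x := by exact_mod_cast h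
  have hx' : (0 : ℚ) ≤ x := by exact_mod_cast hx
  have hxa' : (x : ℚ) < a := by exact_mod_cast hxa
  rw [Int.ceil_eq_iff, lt_div_iff₀ ha, div_le_iff₀ ha]
  constructor <;> nlinarith

/-- A decomposition of an integer as `c * t + d * z` is determined by `0 ≤ z < c`. -/
lemma eq_of_mul_add_mul_eq {c d t z t' z' : ℤ} (hcd : IsCoprime c d) (hz : 0 ≤ z) (hzc : z < c)
    (hz' : 0 ≤ z') (hzc' : z' < c) (h : c * t + d * z = c * t' + d * z') : t = t' ∧ z = z' := by
  have hdvd : c ∣ z - z' := hcd.dvd_of_dvd_mul_left ⟨t' - t, by linear_combination h⟩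
  have hzz : z = z' := by
    have := Int.eq_zero_of_abs_lt_dvd hdvd (by rw [abs_lt]; constructor <;> linarith)
    linarith
  subst hzz
  exact ⟨mul_left_cancel₀ (by linarith : c ≠ 0) (by linarith), rfl⟩

/-- A multiple of `a * c` lies between `n` and `N`. -/
lemma exists_mul_mem_Icc {a b c N n : ℤ} (hcop : IsCoprime a b) (h1a : 1 < a)
    (hab : a < b) (hbc : b < c)
    (hne23 : ¬(a = 2 ∧ b = 3)) (hN : N = a * b * c - a * b - a * c - b * c)
    (hn : a * b < n) (hnN : 2 * n ≤ N + 1) :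
    ∃ j : ℤ, 0 ≤ j ∧ n ≤ c * (j * a) ∧ c * (j * a) ≤ N := by
  have ha : 0 < a := by linarith
  have hb : 0 < b := by linarith
  have hc : 0 < c := by linarith
  have hac : 0 < a * c := by positivity
  have hab0 : 0 < a * b := by positivity
  have hN0 : 0 ≤ N := by linarith
  have hdm := Int.mul_ediv_add_emod N (a * c)
  have hmod := Int.emod_lt_of_pos N hac
  have hmod0 := Int.emod_nonneg N hac.ne'
  have hj0 : 0 ≤ N / (a * c) := Int.ediv_nonneg hN0 hac.le
  refine ⟨N / (a * c), hj0, ?_, by linarith⟩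
  rcases hj0.eq_or_lt with hj | hj
  · exfalso
    rw [← hj] at hdm
    have hlt : N < a * c := by linarith
    have h3 : c * (3 * (a * b - 2 * a - b)) < c * (a * b - a - b) := by linarith
    have h4 := lt_of_mul_lt_mul_left h3 (by linarith)
    rcases (by lia : a = 2 ∨ a = 3 ∨ 4 ≤ a) with rfl | rfl | ha
    · obtain rfl : b = 4 := by lia
      obtain ⟨u, v, huv⟩ := hcop
      lia
    · lia
    · nlinarith
  · nlinarith

open Classical in
lemma card_le_card_reflect {a b c N : ℤ} {n : ℕ} (hab : IsCoprime a b) (hac : IsCoprime a c)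
    (hbc : IsCoprime b c) (h1a : 1 < a) (hab' : a < b) (hbc' : b < c)
    (hne23 : ¬(a = 2 ∧ b = 3)) (hN : N = a * b * c - a * b - a * c - b * c)
    (hn : a * b < n) (hnN : 2 * (n : ℤ) ≤ N + 1) :
    #((range n).filter fun k : ℕ => InSemigroup a b c k) ≤
      #((range n).filter fun k : ℕ => InSemigroup a b c (N - k)) := by
  obtain ⟨j, hj, hjn, hjN⟩ := exists_mul_mem_Icc hab h1a hab' hbc' hne23 hN hn hnN
  have ha : 0 < a := by linarith
  have hb : 0 < b := by linarith
  have hc : 0 < c := by linarith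
  have hab0 : 0 < a * b := by positivity
  have hcop : IsCoprime c (a * b) := (IsCoprime.mul_left hac hbc).symm
  have hN' : N < a * b * c := by nlinarith
  -- a column is a set `{c * t + a * b * z | 0 ≤ z}`; `w t` is the last index below `N`
  let w : ℤ → ℤ := fun t => (N - c * t) / (a * b)
  have hw₁ : ∀ t, c * t + a * b * w t ≤ N := fun t => by
    have := Int.mul_ediv_self_le (x := N - c * t) hab0.ne'
    simp only [w]; linarith
  have hw₂ : ∀ t, N < c * t + a * b * w t + a * b := fun t => by
    have := Int.lt_mul_ediv_self_add (x := N - c * t) hab0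
    simp only [w]; linarith
  have hrep : ∀ k : ℕ, ∃ t z : ℤ, InSemigroup a b c k →
      (∃ x y : ℤ, 0 ≤ x ∧ 0 ≤ y ∧ t = x * b + y * a) ∧ 0 ≤ z ∧ (k : ℤ) = c * t + a * b * z := by
    intro k
    by_cases hk : InSemigroup a b c k
    · obtain ⟨x, y, z, hx, hy, hz, h⟩ := hk
      exact ⟨x * b + y * a, z, fun _ => ⟨⟨x, y, hx, hy, rfl⟩, hz, by rw [h]; ring⟩⟩
    · exact ⟨0, 0, fun h => absurd h hk⟩
  choose t z htz using hrep
  -- the reflected element of the column of `k`, or the last element of the column of `c * j * a`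
  let T : ℕ → ℤ := fun k => if t k = 0 ∧ (n : ℤ) < a * b * (z k + 1) then j * a else t k
  let Z : ℕ → ℤ := fun k => if t k = 0 ∧ (n : ℤ) < a * b * (z k + 1) then w (j * a)
    else w (t k) - z k
  have key : ∀ k < n, InSemigroup a b c k → (∃ x y : ℤ, 0 ≤ x ∧ 0 ≤ y ∧ T k = x * b + y * a) ∧
      0 ≤ Z k ∧ c * T k + a * b * Z k ≤ N ∧ N - n < c * T k + a * b * Z k := by
    intro k hkn hk
    obtain ⟨⟨x, y, hx, hy, hxy⟩, hz, hkt⟩ := htz k hk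
    have hkn' : (k : ℤ) < n := by exact_mod_cast hkn
    by_cases hc : t k = 0 ∧ (n : ℤ) < a * b * (z k + 1)
    · simp only [T, Z, if_pos hc]
      refine ⟨⟨0, j, le_rfl, hj, by ring⟩, ?_, hw₁ _, by linarith [hw₂ (j * a)]⟩
      exact Int.ediv_nonneg (by linarith) hab0.le
    · simp only [T, Z, if_neg hc]
      have hle : a * b * (z k + 1) ≤ n := by
        by_cases ht : t k = 0
        · exact not_lt.1 fun h => hc ⟨ht, h⟩
        · have hta : a ≤ t k := by
            rcases hx.eq_or_lt with hx0 | hx0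
            · rcases hy.eq_or_lt with hy0 | hy0
              · exact absurd (by rw [hxy, ← hx0, ← hy0]; ring) ht
              · nlinarith
            · nlinarith
          have : a * b ≤ c * t k := by nlinarith
          linarith
      refine ⟨⟨x, y, hx, hy, hxy⟩, ?_, ?_, ?_⟩
      · have : z k ≤ w (t k) := by
          rw [Int.le_ediv_iff_mul_le hab0]
          linarith
        linarith
      · have := hw₁ (t k)
        nlinarith
      · have := hw₂ (t k)
        nlinarith
  have hT0 : ∀ k < n, InSemigroup a b c k → 0 ≤ c * T k := by
    intro k hkn hk
    obtain ⟨⟨x, y, hx, hy, h⟩, -⟩ := key k hkn hk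
    rw [h]
    positivity
  have hZc : ∀ k < n, InSemigroup a b c k → Z k < c := by
    intro k hkn hk
    have := hT0 k hkn hk
    have := (key k hkn hk).2.2.1
    exact lt_of_mul_lt_mul_left (a := a * b) (by linarith) hab0.le
  refine card_le_card_of_injOn (fun k => (N - (c * T k + a * b * Z k)).toNat) ?_ ?_
  · intro k hk
    simp only [coe_filter, mem_range, Set.mem_ofPred_eq] at hk ⊢
    obtain ⟨⟨x, y, hx, hy, h⟩, h1, h2, h3⟩ := key k hk.1 hk.2
    refine ⟨by lia, ?_⟩
    rw [Int.toNat_of_nonneg (by linarith)]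
    exact ⟨x, y, Z k, hx, hy, h1, by rw [h]; ring⟩
  · intro k hk l hl hkl
    simp only [coe_filter, mem_range, Set.mem_ofPred_eq] at hk hl hkl
    obtain ⟨-, hk1, hk2, -⟩ := key k hk.1 hk.2
    obtain ⟨-, hl1, hl2, -⟩ := key l hl.1 hl.2
    obtain ⟨hT, hZ⟩ := eq_of_mul_add_mul_eq hcop hk1 (hZc k hk.1 hk.2) hl1 (hZc l hl.1 hl.2)
      (by lia : c * T k + a * b * Z k = c * T l + a * b * Z l)
    obtain ⟨-, hzk, hkt⟩ := htz k hk.2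
    obtain ⟨-, hzl, hlt⟩ := htz l hl.2
    have hkn' : (k : ℤ) < n := by exact_mod_cast hk.1
    have hln' : (l : ℤ) < n := by exact_mod_cast hl.1
    simp only [T, Z] at hT hZ
    split_ifs at hT hZ with h1 h2 h2
    · have hz : z k = z l := by
        rw [h1.1] at hkt
        rw [h2.1] at hlt
        have h3 : z k < z l + 1 := lt_of_mul_lt_mul_left (a := a * b) (by linarith) hab0.le
        have h4 : z l < z k + 1 := lt_of_mul_lt_mul_left (a := a * b) (by linarith) hab0.le
        linarith
      rw [h1.1, hz] at hkt
      rw [h2.1] at hlt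
      exact_mod_cast hkt.trans hlt.symm
    · have : 0 ≤ a * b * z l := by positivity
      rw [← hT] at hlt
      linarith
    · have : 0 ≤ a * b * z k := by positivity
      rw [hT] at hkt
      linarith
    · rw [hT] at hZ hkt
      have hz : z k = z l := by linarith
      rw [hz] at hkt
      exact_mod_cast hkt.trans hlt.symm

/-- Every integer is `x * bc + y * ac + z * ab` modulo `abc`, with reduced digits `x`, `y`, `z`. -/
lemma exists_reduced_representation {a b c e₀ p₁ p₂ p₃ : ℤ} (ha : 0 < a) (hb : 0 < b) (hc : 0 < c)
    (heq : a * b * c * e₀ + p₁ * (b * c) + p₂ * (a * c) + p₃ * (a * b) = -1) (k : ℤ) :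
    ∃ x y z q : ℤ, (0 ≤ x ∧ x < a) ∧ (0 ≤ y ∧ y < b) ∧ (0 ≤ z ∧ z < c) ∧
      k = x * (b * c) + y * (a * c) + z * (a * b) + a * b * c * q := by
  refine ⟨(-p₁ * k) % a, (-p₂ * k) % b, (-p₃ * k) % c,
    -e₀ * k + (-p₁ * k) / a + (-p₂ * k) / b + (-p₃ * k) / c,
    ⟨Int.emod_nonneg _ ha.ne', Int.emod_lt_of_pos _ ha⟩,
    ⟨Int.emod_nonneg _ hb.ne', Int.emod_lt_of_pos _ hb⟩,
    ⟨Int.emod_nonneg _ hc.ne', Int.emod_lt_of_pos _ hc⟩, ?_⟩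
  have h₁ := Int.mul_ediv_add_emod (-p₁ * k) a
  have h₂ := Int.mul_ediv_add_emod (-p₂ * k) b
  have h₃ := Int.mul_ediv_add_emod (-p₃ * k) c
  linear_combination k * heq - b * c * h₁ - a * c * h₂ - a * b * h₃

/-- The value of `Δ` in terms of a reduced representation. -/
lemma delta_eq_one_add {a b c e₀ p₁ p₂ p₃ k x y z q : ℤ}
    (heq : a * b * c * e₀ + p₁ * (b * c) + p₂ * (a * c) + p₃ * (a * b) = -1)
    (hx : 0 ≤ x ∧ x < a) (hy : 0 ≤ y ∧ y < b) (hz : 0 ≤ z ∧ z < c)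
    (hk : k = x * (b * c) + y * (a * c) + z * (a * b) + a * b * c * q) :
    1 - e₀ * k - ⌈((p₁ : ℚ) * (k : ℚ)) / (a : ℚ)⌉ - ⌈((p₂ : ℚ) * (k : ℚ)) / (b : ℚ)⌉
      - ⌈((p₃ : ℚ) * (k : ℚ)) / (c : ℚ)⌉ = 1 + q := by
  rw [ceil_mul_div_eq (m := p₁ * (y * c + z * b + b * c * q) -
        x * (b * c * e₀ + p₂ * c + p₃ * b)) hx.1 hx.2
      (by rw [hk]; linear_combination -x * heq),
    ceil_mul_div_eq (m := p₂ * (x * c + z * a + a * c * q) -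
        y * (a * c * e₀ + p₁ * c + p₃ * a)) hy.1 hy.2
      (by rw [hk]; linear_combination -y * heq),
    ceil_mul_div_eq (m := p₃ * (x * b + y * a + a * b * q) -
        z * (a * b * e₀ + p₁ * b + p₂ * a)) hz.1 hz.2
      (by rw [hk]; linear_combination -z * heq), hk]
  linear_combination -q * heq

lemma inSemigroup_iff_of_lt {a b c k x y z q : ℤ} (ha : 0 < a) (hb : 0 < b) (hc : 0 < c)
    (hab : IsCoprime a b) (hac : IsCoprime a c) (hbc : IsCoprime b c)
    (hx : 0 ≤ x ∧ x < a) (hy : 0 ≤ y ∧ y < b) (hz : 0 ≤ z ∧ z < c)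
    (hk : k = x * (b * c) + y * (a * c) + z * (a * b) + a * b * c * q) (hlt : k < a * b * c) :
    InSemigroup a b c k ↔ q = 0 := by
  constructor
  · rintro ⟨x', y', z', hx', hy', hz', h⟩
    have h₁ : 0 ≤ x' * (b * c) := by positivity
    have h₂ : 0 ≤ y' * (a * c) := by positivity
    have h₃ : 0 ≤ z' * (a * b) := by positivity
    have hxa : x' < a := lt_of_mul_lt_mul_right (a := b * c) (by linarith) (by positivity)
    have hyb : y' < b := lt_of_mul_lt_mul_right (a := a * c) (by linarith) (by positivity)
    have hzc : z' < c := lt_of_mul_lt_mul_right (a := a * b) (by linarith) (by positivity)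
    obtain ⟨-, rfl⟩ := eq_of_mul_add_mul_eq (c := a) (d := b * c) (t := y * c + z * b + b * c * q)
      (t' := y' * c + z' * b) (hab.mul_right hac) hx.1 hx.2 hx' hxa (by linarith)
    obtain ⟨-, rfl⟩ := eq_of_mul_add_mul_eq (c := b) (d := a * c) (t := x * c + z * a + a * c * q)
      (t' := x * c + z' * a) (hab.symm.mul_right hbc) hy.1 hy.2 hy' hyb (by linarith)
    obtain ⟨-, rfl⟩ := eq_of_mul_add_mul_eq (c := c) (d := a * b) (t := x * b + y * a + a * b * q)
      (t' := x * b + y * a) (hac.symm.mul_right hbc.symm) hz.1 hz.2 hz' hzc (by linarith)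
    have : a * b * c * q = 0 := by linarith
    exact (mul_eq_zero.1 this).resolve_left (by positivity)
  · rintro rfl
    exact ⟨x, y, z, hx.1, hy.1, hz.1, by linarith⟩

open Classical in
lemma delta_eq_sub_indicator {a b c N e₀ p₁ p₂ p₃ k : ℤ} (ha : 0 < a) (hb : 0 < b) (hc : 0 < c)
    (hab : IsCoprime a b) (hac : IsCoprime a c) (hbc : IsCoprime b c)
    (hN : N = a * b * c - a * b - a * c - b * c)
    (heq : a * b * c * e₀ + p₁ * (b * c) + p₂ * (a * c) + p₃ * (a * b) = -1)
    (hk : 0 ≤ k) (hkN : k ≤ N) :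
    1 - e₀ * k - ⌈((p₁ : ℚ) * (k : ℚ)) / (a : ℚ)⌉ - ⌈((p₂ : ℚ) * (k : ℚ)) / (b : ℚ)⌉
      - ⌈((p₃ : ℚ) * (k : ℚ)) / (c : ℚ)⌉ =
      (if InSemigroup a b c k then 1 else 0) - (if InSemigroup a b c (N - k) then 1 else 0) := by
  obtain ⟨x, y, z, q, hx, hy, hz, h⟩ := exists_reduced_representation ha hb hc heq k
  have hab0 : 0 < a * b := by positivity
  have hac0 : 0 < a * c := by positivity
  have hbc0 : 0 < b * c := by positivity
  have habc : 0 < a * b * c := by positivity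
  have hiff := inSemigroup_iff_of_lt ha hb hc hab hac hbc hx hy hz h (by linarith)
  have hiff' : InSemigroup a b c (N - k) ↔ -2 - q = 0 :=
    inSemigroup_iff_of_lt (x := a - 1 - x) (y := b - 1 - y) (z := c - 1 - z) ha hb hc hab hac hbc
      ⟨by lia, by lia⟩ ⟨by lia, by lia⟩ ⟨by lia, by lia⟩ (by rw [hN, h]; ring) (by linarith)
  have hx₁ : 0 ≤ x * (b * c) := mul_nonneg hx.1 hbc0.le
  have hy₁ : 0 ≤ y * (a * c) := mul_nonneg hy.1 hac0.le
  have hz₁ : 0 ≤ z * (a * b) := mul_nonneg hz.1 hab0.le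
  have hx₂ : x * (b * c) < a * (b * c) := mul_lt_mul_of_pos_right hx.2 hbc0
  have hy₂ : y * (a * c) < b * (a * c) := mul_lt_mul_of_pos_right hy.2 hac0
  have hz₂ : z * (a * b) < c * (a * b) := mul_lt_mul_of_pos_right hz.2 hab0
  have hq₁ : q < 1 := lt_of_mul_lt_mul_left (a := a * b * c) (by linarith) habc.le
  have hq₂ : -3 < q := lt_of_mul_lt_mul_left (a := a * b * c) (by linarith) habc.le
  rw [delta_eq_one_add heq hx hy hz h, hiff, hiff']
  split_ifs <;> lia

lemma InSemigroup.eq_zero_of_lt {a b c k : ℤ} (ha : 0 < a) (hab : a < b) (hbc : b < c)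
    (h : InSemigroup a b c k) (hk : k < a * b) : k = 0 := by
  obtain ⟨x, y, z, hx, hy, hz, rfl⟩ := h
  have hb : 0 < b := ha.trans hab
  have hc : 0 < c := hb.trans hbc
  have h₁ : a * b ≤ a * c := mul_le_mul_of_nonneg_left hbc.le ha.le
  have h₂ : a * b ≤ b * c := by nlinarith
  have h₃ : (x + y + z) * (a * b) < 1 * (a * b) := by nlinarith
  have h₄ := lt_of_mul_lt_mul_right h₃ (by positivity)
  obtain rfl : x = 0 := by lia
  obtain rfl : y = 0 := by lia
  obtain rfl : z = 0 := by lia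
  ring

open Classical in
lemma card_filter_inSemigroup_eq_one {a b c : ℤ} {n : ℕ} (ha : 0 < a) (hab : a < b) (hbc : b < c)
    (hn₀ : 1 ≤ n) (hn : n ≤ a * b) : #((range n).filter fun k : ℕ => InSemigroup a b c k) = 1 := by
  rw [card_eq_one]
  refine ⟨0, ?_⟩
  ext k
  simp only [mem_filter, mem_range, mem_singleton]
  constructor
  · rintro ⟨hkn, hk⟩
    exact_mod_cast hk.eq_zero_of_lt ha hab hbc (by lia)
  · rintro rfl
    exact ⟨hn₀, 0, 0, 0, le_rfl, le_rfl, le_rfl, by simp⟩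

/-- Partial sums of a function that is antisymmetric about `M / 2` are symmetric. -/
lemma sum_range_eq_of_antisymm {f : ℕ → ℤ} {M m n : ℕ} (h : m + n = M + 1)
    (hf : ∀ i j, i + j = M → f i = -f j) : ∑ i ∈ range m, f i = ∑ i ∈ range n, f i := by
  have hreflect : ∀ m n, m + n = M + 1 →
      ∑ i ∈ range (M + 1), f i = ∑ i ∈ range m, f i - ∑ i ∈ range n, f i := by
    intro m n h
    rw [← h, sum_range_add, ← sum_range_reflect (fun i => f (m + i)), sub_eq_add_neg,
      ← sum_neg_distrib]
    congr 1
    refine sum_congr rfl fun i hi => hf _ _ ?_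
    have := mem_range.1 hi
    lia
  have h₁ := hreflect m n h
  have h₂ := hreflect n m (by lia)
  linarith

/-- If `(a,b) ≠ (2,3)` (and `(a,b,c) ≠ (2,3,5)`), every global maximum of
the tau function is trivial: whenever `τ(n) = 1` with `0 ≤ n ≤ N+1`, either `τ(i) = 1`
for all `1 ≤ i ≤ n`, or `τ(i) = 1` for all `n ≤ i ≤ N`. -/
theorem all_maxima_trivial (a b c : ℤ)
    (hab : IsCoprime a b) (hac : IsCoprime a c) (hbc : IsCoprime b c)
    (h1a : 1 < a) (hab' : a < b) (hbc' : b < c)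
    (hne : (a, b, c) ≠ (2, 3, 5))
    (hne23 : ¬(a = 2 ∧ b = 3))
    (N : ℤ) (hN : N = a * b * c - a * b - a * c - b * c)
    (e₀ p₁ p₂ p₃ : ℤ)
    (hp₁ : 0 < p₁ ∧ p₁ < a) (hp₂ : 0 < p₂ ∧ p₂ < b) (hp₃ : 0 < p₃ ∧ p₃ < c)
    (heq : a * b * c * e₀ + p₁ * (b * c) + p₂ * (a * c) + p₃ * (a * b) = -1)
    (Δ : ℕ → ℤ)
    (hΔ : ∀ n : ℕ, Δ n = 1 - e₀ * (n : ℤ)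
      - ⌈((p₁ : ℚ) * (n : ℚ)) / (a : ℚ)⌉
      - ⌈((p₂ : ℚ) * (n : ℚ)) / (b : ℚ)⌉
      - ⌈((p₃ : ℚ) * (n : ℚ)) / (c : ℚ)⌉)
    (τ : ℕ → ℤ)
    (hτ : ∀ i : ℕ, τ i = ∑ n ∈ Finset.range i, Δ n) :
    ∀ n : ℕ, (n : ℤ) ≤ N + 1 → τ n = 1 →
      (∀ i : ℕ, 1 ≤ i → i ≤ n → τ i = 1) ∨
      (∀ i : ℕ, n ≤ i → (i : ℤ) ≤ N → τ i = 1) := by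
  classical
  intro n hn hτn
  have ha : 0 < a := by linarith
  have hb : 0 < b := by linarith
  have hc : 0 < c := by linarith
  have hΔG : ∀ k : ℕ, (k : ℤ) ≤ N → Δ k = (if InSemigroup a b c k then 1 else 0) -
      (if InSemigroup a b c (N - k) then 1 else 0) := fun k hk => by
    have := delta_eq_sub_indicator ha hb hc hab hac hbc hN heq (Int.natCast_nonneg k) hk
    rw [hΔ, ← this]
    simp only [Int.cast_natCast]
  have hτG : ∀ i : ℕ, (i : ℤ) ≤ N + 1 →
      τ i = #((range i).filter fun k : ℕ => InSemigroup a b c k) -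
      #((range i).filter fun k : ℕ => InSemigroup a b c (N - k)) := fun i hi => by
    rw [hτ, card_filter, card_filter]
    push_cast
    rw [← sum_sub_distrib]
    refine sum_congr rfl fun k hk => hΔG k ?_
    have := mem_range.1 hk
    lia
  have hpos : ∀ i : ℕ, τ i = 1 → 1 ≤ i := fun i hi => by
    rcases i.eq_zero_or_pos with rfl | h
    · simp [hτ] at hi
    · exact h
  have hlower : ∀ m : ℕ, 2 * (m : ℤ) ≤ N + 1 → τ m = 1 → ∀ i : ℕ, 1 ≤ i → i ≤ m → τ i = 1 := by
    intro m hm hτm i hi him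
    rw [hτG m (by lia)] at hτm
    rcases le_or_gt (m : ℤ) (a * b) with hmab | hmab
    · rw [card_filter_inSemigroup_eq_one ha hab' hbc' (hi.trans him) hmab] at hτm
      have hle : #((range i).filter fun k : ℕ => InSemigroup a b c (N - k)) ≤
          #((range m).filter fun k : ℕ => InSemigroup a b c (N - k)) :=
        card_le_card (filter_subset_filter _ (range_mono him))
      rw [hτG i (by lia), card_filter_inSemigroup_eq_one ha hab' hbc' hi (by lia)]
      lia
    · have := card_le_card_reflect hab hac hbc h1a hab' hbc' hne23 hN hmab hm
      lia
  rcases le_or_gt (2 * (n : ℤ)) (N + 1) with hle | hgt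
  · exact Or.inl (hlower n hle hτn)
  · right
    intro i hni hiN
    lift N to ℕ using by lia with M
    have hanti : ∀ i j, i + j = M → Δ i = -Δ j := by
      rintro i j rfl
      rw [hΔG i (by push_cast; lia), hΔG j (by push_cast; lia)]
      push_cast
      rw [add_sub_cancel_left, add_sub_cancel_right]
      ring
    have hsymm : ∀ k l, k + l = M + 1 → τ k = τ l := fun k l h => by
      rw [hτ, hτ, sum_range_eq_of_antisymm h hanti]
    rw [hsymm n (M + 1 - n) (by lia)] at hτn
    rw [hsymm i (M + 1 - i) (by lia)]
    exact hlower (M + 1 - n) (by lia) hτn _ (by lia) (by lia)
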